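/- There is no voting method whose domain is the set of all profiles with at most 7 candidates that satisfies anonymity, neutrality, binary quasi-resoluteness, binary γ, and α-resoluteness. -/

import Mathlib

/- Formalization of voting-theoretic notions from Holliday, Norman, Pacuit, Zahedian,
"Impossibility theorems involving weakenings of expansion consistency and resoluteness
in voting". Candidates form an infinite type `C` and voters an infinite type `V`. -/

open Classical

noncomputable section

/-- `L` is a strict linear order on exactly the finite set `s`. -/
def IsStrictLinearOrderOn {C : Type} (s : Finset C) (L : C → C → Prop) : Prop :=
  (∀ x, ¬ L x x) ∧ (∀ x y z, L x y → L y z → L x z) ∧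
    (∀ x ∈ s, ∀ y ∈ s, x ≠ y → L x y ∨ L y x) ∧ ∀ x y, L x y → x ∈ s ∧ y ∈ s

/-- Restriction of a relation to a finite set `A`. -/
def restrictRel {C : Type} (A : Finset C) (L : C → C → Prop) : C → C → Prop :=
  fun x y => L x y ∧ x ∈ A ∧ y ∈ A

theorem IsStrictLinearOrderOn.restrict {C : Type} {s A : Finset C} {L : C → C → Prop}
    (h : IsStrictLinearOrderOn s L) (hA : A ⊆ s) :
    IsStrictLinearOrderOn A (restrictRel A L) := by
  obtain ⟨hirr, htr, htot, hdom⟩ := h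
  refine ⟨fun x hx => hirr x hx.1,
    fun x y z hxy hyz => ⟨htr _ _ _ hxy.1 hyz.1, hxy.2.1, hyz.2.2⟩, ?_,
    fun x y hxy => ⟨hxy.2.1, hxy.2.2⟩⟩
  intro x hx y hy hne
  rcases htot x (hA hx) y (hA hy) hne with h' | h'
  · exact Or.inl ⟨h', hx, hy⟩
  · exact Or.inr ⟨h', hy, hx⟩

/-- The image of a relation under the transposition of `a` and `b`. -/
def swapRel {C : Type} (a b : C) (L : C → C → Prop) : C → C → Prop :=
  fun x y => L (Equiv.swap a b x) (Equiv.swap a b y)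

theorem IsStrictLinearOrderOn.swapRel_mem {C : Type} {s : Finset C} {L : C → C → Prop}
    (a b : C) (h : IsStrictLinearOrderOn s L) :
    IsStrictLinearOrderOn (s.image (Equiv.swap a b)) (swapRel a b L) := by
  obtain ⟨hirr, htr, htot, hdom⟩ := h
  refine ⟨fun x => hirr _, fun x y z hxy hyz => htr _ _ _ hxy hyz, ?_, ?_⟩
  · intro x hx y hy hne
    obtain ⟨x', hx', rfl⟩ := Finset.mem_image.mp hx
    obtain ⟨y', hy', rfl⟩ := Finset.mem_image.mp hy
    have hne' : x' ≠ y' := by rintro rfl; exact hne rfl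
    have := htot x' hx' y' hy' hne'
    simpa [swapRel, Equiv.swap_apply_self] using this
  · intro x y hxy
    obtain ⟨h1, h2⟩ := hdom _ _ hxy
    exact ⟨Finset.mem_image.mpr ⟨_, h1, Equiv.swap_apply_self a b x⟩,
      Finset.mem_image.mpr ⟨_, h2, Equiv.swap_apply_self a b y⟩⟩

/-- A preference profile: each voter in the finite set `voters` submits a strict linear
order of the finite nonempty set `cands` of candidates. -/
structure Profile (C V : Type) where
  voters : Finset V
  cands : Finset C
  cands_nonempty : cands.Nonempty
  ballot : V → C → C → Prop
  ballot_lin : ∀ i ∈ voters, IsStrictLinearOrderOn cands (ballot i)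

namespace Profile

variable {C V : Type}

/-- The margin of `x` over `y` in `P`: the number of voters ranking `x` above `y`
minus the number of voters ranking `y` above `x`. -/
def margin (P : Profile C V) (x y : C) : ℤ :=
  ((P.voters.filter (fun i => P.ballot i x y)).card : ℤ) -
    ((P.voters.filter (fun i => P.ballot i y x)).card : ℤ)

/-- The profile `P^{i⇄j}` obtained by transposing the voters `i` and `j`. -/
def swapVoters (P : Profile C V) (i j : V) : Profile C V where
  voters := P.voters.image (Equiv.swap i j)
  cands := P.cands
  cands_nonempty := P.cands_nonempty
  ballot := fun k => P.ballot (Equiv.swap i j k)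
  ballot_lin := by
    intro k hk
    obtain ⟨m, hm, rfl⟩ := Finset.mem_image.mp hk
    simpa [Equiv.swap_apply_self] using P.ballot_lin m hm

/-- The profile `P_{a⇄b}` obtained by transposing the candidates `a` and `b`. -/
def swapCands (P : Profile C V) (a b : C) : Profile C V where
  voters := P.voters
  cands := P.cands.image (Equiv.swap a b)
  cands_nonempty := P.cands_nonempty.image _
  ballot := fun i => swapRel a b (P.ballot i)
  ballot_lin := fun i hi => (P.ballot_lin i hi).swapRel_mem a b

/-- The restriction `P|_A` of a profile to a nonempty subset `A` of its candidates. -/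
def restrict (P : Profile C V) (A : Finset C) (hA : A.Nonempty) (hsub : A ⊆ P.cands) :
    Profile C V where
  voters := P.voters
  cands := A
  cands_nonempty := hA
  ballot := fun i => restrictRel A (P.ballot i)
  ballot_lin := fun i hi => (P.ballot_lin i hi).restrict hsub

/-- The profile `P_{-y}`, i.e. `P` with the candidate `y` removed. -/
def minus (P : Profile C V) (y : C) (h : (P.cands.erase y).Nonempty) : Profile C V :=
  P.restrict (P.cands.erase y) h (P.cands.erase_subset y)

/-- The profile `P|_{{x,y}}`, i.e. `P` restricted to the two candidates `x` and `y`. -/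
def pair (P : Profile C V) (x y : C) (hx : x ∈ P.cands) (hy : y ∈ P.cands) : Profile C V :=
  P.restrict {x, y} ⟨x, Finset.mem_insert_self x {y}⟩
    (by
      intro z hz
      rcases Finset.mem_insert.mp hz with rfl | hz
      · exact hx
      · rcases Finset.mem_singleton.mp hz with rfl
        exact hy)

/-- `P` is uniquely weighted: no two distinct ordered pairs of distinct candidates
have the same margin. -/
def UniquelyWeighted (P : Profile C V) : Prop :=
  ∀ a ∈ P.cands, ∀ b ∈ P.cands, ∀ x ∈ P.cands, ∀ y ∈ P.cands,
    a ≠ b → x ≠ y → (a, b) ≠ (x, y) → P.margin a b ≠ P.margin x y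

/-- `P` is uniquely ranked: in every subelection with at least two candidates, no two
candidates have the same number of `n`-th place votes, and no two candidates have the
same Borda score. -/
def UniquelyRanked (P : Profile C V) : Prop :=
  ∀ Y ⊆ P.cands, 2 ≤ Y.card →
    ((∀ n : ℕ, 1 ≤ n → n ≤ Y.card → ∀ x ∈ Y, ∀ y ∈ Y, x ≠ y →
        (P.voters.filter
            (fun i => (Y.filter (fun z => P.ballot i z x)).card = n - 1)).card ≠
          (P.voters.filter
            (fun i => (Y.filter (fun z => P.ballot i z y)).card = n - 1)).card) ∧
      (∀ x ∈ Y, ∀ y ∈ Y, x ≠ y →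
        (∑ i ∈ P.voters, (Y.filter (fun z => P.ballot i x z)).card) ≠
          ∑ i ∈ P.voters, (Y.filter (fun z => P.ballot i y z)).card))

/-- `Q` is an `n`-fold copy `nP` of `P`: same candidates, and there is a map sending
the voters of `Q` onto the voters of `P` such that each voter of `P` has exactly `n`
preimages, each with the same ballot. -/
def IsCopy (Q P : Profile C V) (n : ℕ) : Prop :=
  Q.cands = P.cands ∧
    ∃ h : V → V,
      (∀ j ∈ Q.voters, h j ∈ P.voters) ∧
      (∀ i ∈ P.voters, (Q.voters.filter (fun j => h j = i)).card = n) ∧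
      (∀ j ∈ Q.voters, Q.ballot j = P.ballot (h j))

/-- `Q` is obtained from `P` by deleting one voter with each linear order of the
candidates of `P`. -/
def IsCancelOf (Q P : Profile C V) : Prop :=
  Q.cands = P.cands ∧ Q.voters ⊆ P.voters ∧
    (∀ j ∈ Q.voters, Q.ballot j = P.ballot j) ∧
    ∀ L : C → C → Prop, IsStrictLinearOrderOn P.cands L →
      ((P.voters \ Q.voters).filter (fun i => P.ballot i = L)).card = 1

end Profile

/-- A voting method: a function assigning to each profile in a nonempty domain a
nonempty set of winners among its candidates. -/
structure VotingMethod (C V : Type) where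
  dom : Set (Profile C V)
  dom_nonempty : dom.Nonempty
  winners : Profile C V → Finset C
  winners_nonempty : ∀ P ∈ dom, (winners P).Nonempty
  winners_sub : ∀ P ∈ dom, winners P ⊆ P.cands

namespace VotingMethod

variable {C V : Type}

/-- Anonymity: transposing two voters does not change the winners. -/
def Anonymous (F : VotingMethod C V) : Prop :=
  ∀ P ∈ F.dom, ∀ i j : V, P.swapVoters i j ∈ F.dom →
    F.winners (P.swapVoters i j) = F.winners P

/-- Neutrality: transposing two candidates transposes the winners accordingly. -/
def Neutral (F : VotingMethod C V) : Prop :=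
  ∀ P ∈ F.dom, ∀ a b : C, P.swapCands a b ∈ F.dom →
    F.winners (P.swapCands a b) = (F.winners P).image (Equiv.swap a b)

/-- Binary resoluteness: a unique winner in any two-candidate profile. -/
def BinaryResolute (F : VotingMethod C V) : Prop :=
  ∀ P ∈ F.dom, P.cands.card = 2 → (F.winners P).card = 1

/-- Binary quasi-resoluteness: a unique winner in any two-candidate profile whose
two distinct candidates have a nonzero margin between them. -/
def BinaryQuasiResolute (F : VotingMethod C V) : Prop :=
  ∀ P ∈ F.dom, P.cands.card = 2 →
    (∀ x ∈ P.cands, ∀ y ∈ P.cands, x ≠ y → P.margin x y ≠ 0) →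
    (F.winners P).card = 1

/-- Quasi-resoluteness: a unique winner in any uniquely weighted profile. -/
def QuasiResolute (F : VotingMethod C V) : Prop :=
  ∀ P ∈ F.dom, P.UniquelyWeighted → (F.winners P).card = 1

/-- Weak quasi-resoluteness: a unique winner in any profile that is both uniquely
weighted and uniquely ranked. -/
def WeakQuasiResolute (F : VotingMethod C V) : Prop :=
  ∀ P ∈ F.dom, P.UniquelyWeighted → P.UniquelyRanked → (F.winners P).card = 1

/-- Binary γ: if `x` wins without `y` and wins the head-to-head against `y`,
then `x` wins with `y` included. -/
def BinaryGamma (F : VotingMethod C V) : Prop :=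
  ∀ P ∈ F.dom, ∀ x, ∀ hx : x ∈ P.cands, ∀ y, ∀ hy : y ∈ P.cands, x ≠ y →
    ∀ h : (P.cands.erase y).Nonempty,
      P.minus y h ∈ F.dom → P.pair x y hx hy ∈ F.dom →
      x ∈ F.winners (P.minus y h) → F.winners (P.pair x y hx hy) = {x} →
      x ∈ F.winners P

/-- α-resoluteness: if `x` wins without `y` and wins the head-to-head against `y`,
then adding `y` does not enlarge the set of winners. -/
def AlphaResolute (F : VotingMethod C V) : Prop :=
  ∀ P ∈ F.dom, ∀ x, ∀ hx : x ∈ P.cands, ∀ y, ∀ hy : y ∈ P.cands, x ≠ y →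
    ∀ h : (P.cands.erase y).Nonempty,
      P.minus y h ∈ F.dom → P.pair x y hx hy ∈ F.dom →
      x ∈ F.winners (P.minus y h) → F.winners (P.pair x y hx hy) = {x} →
      (F.winners P).card ≤ (F.winners (P.minus y h)).card

/-- Homogeneity: replacing each voter by `n` copies of that voter does not change
the winners. -/
def Homogeneous (F : VotingMethod C V) : Prop :=
  ∀ P ∈ F.dom, ∀ Q ∈ F.dom, ∀ n : ℕ, 0 < n → Q.IsCopy P n → F.winners Q = F.winners P

/-- Cancellativity: deleting one voter with each linear order of the candidates does
not change the winners. -/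
def Cancellative (F : VotingMethod C V) : Prop :=
  ∀ P ∈ F.dom, ∀ Q ∈ F.dom, Q.IsCancelOf P → F.winners Q = F.winners P

/-- Majoritarianism: the winners depend only on the majority graph of the profile. -/
def Majoritarian (F : VotingMethod C V) : Prop :=
  ∀ P ∈ F.dom, ∀ P' ∈ F.dom, P.cands = P'.cands →
    (∀ x ∈ P.cands, ∀ y ∈ P.cands, (0 < P.margin x y ↔ 0 < P'.margin x y)) →
    F.winners P = F.winners P'

/-- Pairwiseness: the winners depend only on the margin graph of the profile. -/
def Pairwise (F : VotingMethod C V) : Prop :=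
  ∀ P ∈ F.dom, ∀ P' ∈ F.dom, P.cands = P'.cands →
    (∀ x ∈ P.cands, ∀ y ∈ P.cands, P.margin x y = P'.margin x y) →
    F.winners P = F.winners P'

end VotingMethod

/-- A tournament on six vertices. -/
structure Tour6 where
  r : Fin 6 → Fin 6 → Bool
  asymm : ∀ x y, r x y = true → r y x = false
  total : ∀ x y, x ≠ y → r x y = true ∨ r y x = true

def Tour6.rev (T : Tour6) : Tour6 :=
  ⟨fun x y => T.r y x, fun x y h => T.asymm y x h, fun x y h => T.total y x h.symm⟩

theorem Tour6.irr (T : Tour6) (x : Fin 6) : ¬ T.r x x = true := fun h => by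
  have := T.asymm x x h
  simp [h] at this

/-- The ballot: rank by `p`, except that the two top ranked candidates are ordered by `T`. -/
def bal6 (T : Tour6) (p : Equiv.Perm (Fin 6)) (x y : Fin 6) : Prop :=
  (p x ≤ 1 ∧ p y ≤ 1 ∧ T.r x y = true) ∨ (¬ (p x ≤ 1 ∧ p y ≤ 1) ∧ p x < p y)

theorem bal6_irr (T : Tour6) (p : Equiv.Perm (Fin 6)) (x : Fin 6) : ¬ bal6 T p x x := by
  rintro (⟨_, _, h⟩ | ⟨_, h⟩)
  · exact T.irr x h
  · exact lt_irrefl _ h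

theorem bal6_trans (T : Tour6) (p : Equiv.Perm (Fin 6)) (x y z : Fin 6)
    (h1 : bal6 T p x y) (h2 : bal6 T p y z) : bal6 T p x z := by
  have key : ∀ a b c : Fin 6, a ≤ 1 → b ≤ 1 → c ≤ 1 → a = b ∨ b = c ∨ a = c := by decide
  rcases h1 with ⟨a1, a2, a3⟩ | ⟨a1, a2⟩ <;> rcases h2 with ⟨b1, b2, b3⟩ | ⟨b1, b2⟩
  · rcases key _ _ _ a1 a2 b2 with h | h | h
    · rw [p.injective h] at a3; exact absurd a3 (T.irr _)
    · rw [p.injective h] at b3; exact absurd b3 (T.irr _)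
    · rw [p.injective h] at a3
      have := T.asymm _ _ a3
      simp [this] at b3
  · right
    have : ¬ p z ≤ 1 := fun h => b1 ⟨a2, h⟩
    exact ⟨fun h => this h.2, lt_of_le_of_lt a1 (not_le.mp this)⟩
  · exact absurd ⟨le_trans a2.le b1, b1⟩ a1
  · right
    refine ⟨fun h => b1 ⟨?_, h.2⟩, a2.trans b2⟩
    exact b2.le.trans h.2

theorem bal6_total (T : Tour6) (p : Equiv.Perm (Fin 6)) (x y : Fin 6) (h : x ≠ y) :
    bal6 T p x y ∨ bal6 T p y x := by
  unfold bal6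
  have hp : p x ≠ p y := fun e => h (p.injective e)
  by_cases hh : p x ≤ 1 ∧ p y ≤ 1
  · rcases T.total x y h with h' | h'
    · left; left; exact ⟨hh.1, hh.2, h'⟩
    · right; left; exact ⟨hh.2, hh.1, h'⟩
  · rcases lt_or_gt_of_ne hp with h' | h'
    · left; right; exact ⟨hh, h'⟩
    · right; right; exact ⟨fun a => hh a.symm, h'⟩

section construction6

variable {C V : Type} (e : Fin 6 ↪ C) (v : Equiv.Perm (Fin 6) ↪ V)

/-- The profile. -/
def prof6 (T : Tour6) (A : Finset (Fin 6)) (hA : A.Nonempty) (σ : Equiv.Perm (Fin 6))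
    (τ : Equiv.Perm (Equiv.Perm (Fin 6))) : Profile C V where
  voters := Finset.univ.map v
  cands := A.image (fun x => e (σ x))
  cands_nonempty := hA.image _
  ballot := fun i c d => ∃ p x y, i = v p ∧ c = e (σ x) ∧ d = e (σ y) ∧ x ∈ A ∧ y ∈ A ∧
    bal6 T (τ p) x y
  ballot_lin := by
    intro i _
    rename_i hi
    obtain ⟨p, _, rfl⟩ := Finset.mem_map.mp hi
    refine ⟨?_, ?_, ?_, ?_⟩
    · rintro c ⟨q, x, y, h1, h2, h3, _, _, h⟩
      have : x = y := σ.injective (e.injective (h2.symm.trans h3))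
      subst this
      exact bal6_irr _ _ _ h
    · rintro c d f ⟨q, x, y, h1, h2, h3, hx, hy, h⟩ ⟨q', x', y', h1', h2', h3', hx', hy', h'⟩
      have : y = x' := σ.injective (e.injective (h3.symm.trans h2'))
      subst this
      have : q = q' := v.injective (h1.symm.trans h1')
      subst this
      exact ⟨q, x, y', h1, h2, h3', hx, hy', bal6_trans _ _ _ _ _ h h'⟩
    · intro c hc d hd hne
      obtain ⟨x, hx, rfl⟩ := Finset.mem_image.mp hc
      obtain ⟨y, hy, rfl⟩ := Finset.mem_image.mp hd
      have : x ≠ y := fun h => hne (by rw [h])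
      rcases bal6_total T (τ p) x y this with h | h
      · exact Or.inl ⟨p, x, y, rfl, rfl, rfl, hx, hy, h⟩
      · exact Or.inr ⟨p, y, x, rfl, rfl, rfl, hy, hx, h⟩
    · rintro c d ⟨q, x, y, h1, h2, h3, hx, hy, h⟩
      exact ⟨Finset.mem_image.mpr ⟨x, hx, h2.symm⟩, Finset.mem_image.mpr ⟨y, hy, h3.symm⟩⟩

theorem Profile.ext6 {P Q : Profile C V} (h1 : P.voters = Q.voters) (h2 : P.cands = Q.cands)
    (h3 : ∀ i c d, P.ballot i c d ↔ Q.ballot i c d) : P = Q := by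
  obtain ⟨a, b, c, d, f⟩ := P
  obtain ⟨a', b', c', d', f'⟩ := Q
  simp only at h1 h2
  subst h1 h2
  have : d = d' := by
    funext i c d
    exact propext (h3 i c d)
  subst this
  rfl

theorem prof6_swapVoters (T : Tour6) (A : Finset (Fin 6)) (hA : A.Nonempty)
    (σ : Equiv.Perm (Fin 6)) (τ : Equiv.Perm (Equiv.Perm (Fin 6))) (i j : Equiv.Perm (Fin 6)) :
    (prof6 e v T A hA σ τ).swapVoters (v i) (v j) =
      prof6 e v T A hA σ (τ * Equiv.swap i j) := by
  have sw : ∀ p, Equiv.swap (v i) (v j) (v p) = v (Equiv.swap i j p) := fun p =>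
    v.injective.swap_apply i j p
  apply Profile.ext6
  · ext k
    simp only [Profile.swapVoters, prof6, Finset.mem_image, Finset.mem_map, Finset.mem_univ,
      true_and]
    constructor
    · rintro ⟨_, ⟨p, rfl⟩, rfl⟩
      exact ⟨_, (sw p).symm⟩
    · rintro ⟨p, rfl⟩
      exact ⟨v (Equiv.swap i j p), ⟨_, rfl⟩, by rw [sw]; simp⟩
  · rfl
  · intro k c d
    simp only [Profile.swapVoters, prof6]
    constructor
    · rintro ⟨p, x, y, h1, h⟩
      refine ⟨Equiv.swap i j p, x, y, ?_, ?_⟩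
      · rw [← sw, ← h1]; simp
      · simpa using h
    · rintro ⟨p, x, y, h1, h⟩
      refine ⟨Equiv.swap i j p, x, y, ?_, ?_⟩
      · rw [h1, sw]
      · simpa using h

theorem prof6_swapCands (T : Tour6) (A : Finset (Fin 6)) (hA : A.Nonempty)
    (σ : Equiv.Perm (Fin 6)) (τ : Equiv.Perm (Equiv.Perm (Fin 6))) (a b : Fin 6) :
    (prof6 e v T A hA σ τ).swapCands (e a) (e b) =
      prof6 e v T A hA (Equiv.swap a b * σ) τ := by
  have sw : ∀ p, Equiv.swap (e a) (e b) (e p) = e (Equiv.swap a b p) := fun p =>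
    e.injective.swap_apply a b p
  apply Profile.ext6
  · rfl
  · simp only [Profile.swapCands, prof6, Finset.image_image]
    apply Finset.image_congr
    intro x _
    simp [sw]
  · intro k c d
    have sw' : ∀ c p, Equiv.swap (e a) (e b) c = e p ↔ c = e (Equiv.swap a b p) := by
      intro c p
      rw [← sw, Equiv.swap_apply_eq_iff]
    simp only [Profile.swapCands, prof6, swapRel, sw', Equiv.Perm.mul_apply]

theorem prof6_minus (T : Tour6) (A : Finset (Fin 6)) (hA : A.Nonempty) (y : Fin 6)
    (hy : (A.erase y).Nonempty) (h) :
    (prof6 e v T A hA 1 1).minus (e y) h = prof6 e v T (A.erase y) hy 1 1 := by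
  have hc : (A.image (fun x => e ((1 : Equiv.Perm (Fin 6)) x))).erase (e y) =
      (A.erase y).image (fun x => e ((1 : Equiv.Perm (Fin 6)) x)) := by
    simp only [Equiv.Perm.one_apply]
    exact (Finset.image_erase e.injective A y).symm
  apply Profile.ext6
  · rfl
  · exact hc
  · intro k c d
    simp only [Profile.minus, Profile.restrict, restrictRel]
    have hc' : (prof6 e v T A hA 1 1).cands.erase (e y) = _ := hc
    rw [hc']
    simp only [prof6]
    constructor
    · rintro ⟨⟨p, x, z, h1, rfl, rfl, hx, hz, h⟩, h3, h4⟩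
      refine ⟨p, x, z, h1, rfl, rfl, ?_, ?_, h⟩
      · simpa using h3
      · simpa using h4
    · rintro ⟨p, x, z, h1, rfl, rfl, hx, hz, h⟩
      exact ⟨⟨p, x, z, h1, rfl, rfl, Finset.mem_of_mem_erase hx, Finset.mem_of_mem_erase hz, h⟩,
        Finset.mem_image_of_mem _ hx, Finset.mem_image_of_mem _ hz⟩

theorem prof6_pair (T : Tour6) (A : Finset (Fin 6)) (hA : A.Nonempty) (x y : Fin 6)
    (hx : x ∈ A) (hy : y ∈ A) (hx') (hy') (hne : ({x, y} : Finset (Fin 6)).Nonempty) :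
    (prof6 e v T A hA 1 1).pair (e x) (e y) hx' hy' = prof6 e v T {x, y} hne 1 1 := by
  apply Profile.ext6
  · rfl
  · simp [Profile.pair, Profile.restrict, prof6, Finset.image_insert]
  · intro k c d
    simp only [Profile.pair, Profile.restrict, restrictRel, prof6]
    constructor
    · rintro ⟨⟨p, x, z, h1, rfl, rfl, hx, hz, h⟩, h3, h4⟩
      refine ⟨p, x, z, h1, rfl, rfl, ?_, ?_, h⟩
      · simpa using h3
      · simpa using h4
    · rintro ⟨p, a, b, h1, rfl, rfl, ha, hb, h⟩
      refine ⟨⟨p, a, b, h1, rfl, rfl, ?_, ?_, h⟩, ?_, ?_⟩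
      · rcases Finset.mem_insert.mp ha with rfl | ha
        · exact hx
        · rw [Finset.mem_singleton.mp ha]; exact hy
      · rcases Finset.mem_insert.mp hb with rfl | hb
        · exact hx
        · rw [Finset.mem_singleton.mp hb]; exact hy
      · simpa using ha
      · simpa using hb

theorem prof6_iso (T T' : Tour6) (A : Finset (Fin 6)) (hA : A.Nonempty)
    (σ : Equiv.Perm (Fin 6)) (hA' : (A.image σ).Nonempty)
    (h : ∀ x ∈ A, ∀ y ∈ A, T'.r (σ x) (σ y) = T.r x y) :
    prof6 e v T' (A.image σ) hA' 1 1 = prof6 e v T A hA σ (Equiv.mulRight σ) := by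
  apply Profile.ext6
  · rfl
  · simp only [prof6, Finset.image_image]
    rfl
  · intro k c d
    simp only [prof6]
    constructor
    · rintro ⟨p, x, y, h1, h2, h3, hx, hy, hb⟩
      obtain ⟨x, hx', rfl⟩ := Finset.mem_image.mp hx
      obtain ⟨y, hy', rfl⟩ := Finset.mem_image.mp hy
      refine ⟨p, x, y, h1, h2, h3, hx', hy', ?_⟩
      simpa [bal6, h x hx' y hy'] using hb
    · rintro ⟨p, x, y, h1, h2, h3, hx, hy, hb⟩
      refine ⟨p, σ x, σ y, h1, h2, h3, Finset.mem_image_of_mem _ hx,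
        Finset.mem_image_of_mem _ hy, ?_⟩
      simpa [bal6, h x hx y hy] using hb

theorem prof6_margin (T : Tour6) (x y : Fin 6) (hxy : T.r x y = true)
    (hne : ({x, y} : Finset (Fin 6)).Nonempty) :
    0 < (prof6 e v T {x, y} hne 1 1).margin (e x) (e y) := by
  have hxne : x ≠ y := by rintro rfl; exact T.irr _ hxy
  have hb : ∀ a b p, a ∈ ({x, y} : Finset (Fin 6)) → b ∈ ({x, y} : Finset (Fin 6)) →
      ((prof6 e v T {x, y} hne 1 1).ballot (v p) (e a) (e b) ↔ bal6 T p a b) := by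
    intro a b p ha hb
    simp only [prof6]
    constructor
    · rintro ⟨q, c, d, h1, h2, h3, _, _, h⟩
      have h1 := v.injective h1
      have h2 := e.injective h2
      have h3 := e.injective h3
      simp only [Equiv.Perm.one_apply] at h1 h2 h3 h
      subst h1 h2 h3
      exact h
    · intro h
      exact ⟨p, a, b, rfl, rfl, rfl, ha, hb, h⟩
  have hx : x ∈ ({x, y} : Finset (Fin 6)) := by simp
  have hy : y ∈ ({x, y} : Finset (Fin 6)) := by simp
  have hcard : ∀ a b, a ∈ ({x, y} : Finset (Fin 6)) → b ∈ ({x, y} : Finset (Fin 6)) →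
      ((prof6 e v T {x, y} hne 1 1).voters.filter
        (fun i => (prof6 e v T {x, y} hne 1 1).ballot i (e a) (e b))).card =
      (Finset.univ.filter (fun p : Equiv.Perm (Fin 6) => bal6 T p a b)).card := by
    intro a b ha hb'
    rw [← Finset.card_map v]
    congr 1
    ext i
    simp only [Finset.mem_filter, Finset.mem_map, Finset.mem_univ, true_and]
    constructor
    · rintro ⟨h1, h2⟩
      obtain ⟨p, _, rfl⟩ := Finset.mem_map.mp h1
      exact ⟨p, (hb a b p ha hb').mp h2, rfl⟩
    · rintro ⟨p, h, rfl⟩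
      exact ⟨Finset.mem_map_of_mem _ (Finset.mem_univ p), (hb a b p ha hb').mpr h⟩
  unfold Profile.margin
  rw [hcard x y hx hy, hcard y x hy hx, sub_pos, Nat.cast_lt]
  rw [← Finset.card_map (Equiv.mulRight (Equiv.swap x y)).toEmbedding]
  apply Finset.card_lt_card
  have hyx : T.r y x = false := T.asymm _ _ hxy
  rw [Finset.ssubset_iff_of_subset]
  · -- a permutation with x at 0 and y at 1
    let q : Equiv.Perm (Fin 6) := Equiv.swap (Equiv.swap x 0 y) 1 * Equiv.swap x 0
    have hq1 : q y = 1 := by simp [q]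
    have hq0 : q x = 0 := by
      simp only [q, Equiv.Perm.mul_apply, Equiv.swap_apply_left]
      apply Equiv.swap_apply_of_ne_of_ne
      · intro h
        apply hxne
        apply (Equiv.swap x 0).injective
        rw [← h]; simp
      · decide
    refine ⟨q, ?_, ?_⟩
    · simp [bal6, hq0, hq1, hxy]
    · simp only [Finset.mem_map, Finset.mem_filter, Finset.mem_univ, true_and, not_exists]
      rintro p ⟨hp, h⟩
      have hp' : p = q * Equiv.swap x y := by
        rw [← h]; simp [mul_assoc]
      subst hp'
      simp [bal6, hq0, hq1, hyx] at hp
  · intro q hq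
    simp only [Finset.mem_map, Finset.mem_filter, Finset.mem_univ, true_and] at hq ⊢
    obtain ⟨p, hp, rfl⟩ := hq
    rcases hp with ⟨_, _, h⟩ | ⟨h1, h2⟩
    · simp [hyx] at h
    · right
      refine ⟨?_, ?_⟩
      · simpa using h1
      · simpa using h2

end construction6

/-- The combinatorial core. -/
structure Core6 (G : Tour6 → Finset (Fin 6) → Finset (Fin 6)) : Prop where
  ne : ∀ T A, A.Nonempty → (G T A).Nonempty
  sub : ∀ T A, A.Nonempty → G T A ⊆ A
  iso : ∀ T T' A (σ : Equiv.Perm (Fin 6)), A.Nonempty →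
    (∀ x ∈ A, ∀ y ∈ A, T'.r (σ x) (σ y) = T.r x y) → ∀ x, σ x ∈ G T' (A.image σ) ↔ x ∈ G T A
  ga : ∀ T A x y, x ∈ A → y ∈ A → T.r x y = true → x ∈ G T (A.erase y) →
    x ∈ G T A ∧ (G T A).card ≤ (G T (A.erase y)).card

def D6 : Tour6 where
  r := fun x y => Nat.testBit (![6, 12, 24, 17, 35, 15] x) y
  asymm := by decide
  total := by decide

def S6 : Tour6 where
  r := fun x y => Nat.testBit (![10, 20, 33, 38, 13, 19] x) y
  asymm := by decide
  total := by decide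

def mk6 (f g : Fin 6 → Fin 6) (h : (∀ x, g (f x) = x) ∧ ∀ x, f (g x) = x) :
    Equiv.Perm (Fin 6) := ⟨f, g, h.1, h.2⟩

theorem Core6.iso' {G} (h : Core6 G) (T T' : Tour6) (A B : Finset (Fin 6))
    (σ : Equiv.Perm (Fin 6)) (hA : A.Nonempty)
    (hr : ∀ x ∈ A, ∀ y ∈ A, T'.r (σ x) (σ y) = T.r x y) (hB : A.image σ = B) :
    (∀ x, σ x ∈ G T' B ↔ x ∈ G T A) ∧ (G T' B).card = (G T A).card := by
  subst hB
  have h1 := h.iso T T' A σ hA hr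
  refine ⟨h1, ?_⟩
  rw [← Finset.card_map σ.toEmbedding (s := G T A)]
  congr 1
  ext z
  obtain ⟨x, rfl⟩ := σ.surjective z
  rw [h1]
  simp

theorem cyc5_aux {X : Finset (Fin 6)} (r0 : 1 ∈ X ↔ 0 ∈ X) (r1 : 2 ∈ X ↔ 1 ∈ X)
    (r2 : 3 ∈ X ↔ 2 ∈ X) (r3 : 4 ∈ X ↔ 3 ∈ X) (w : Fin 6) (hw : w ∈ X)
    (hw' : w ∈ ({0, 1, 2, 3, 4} : Finset (Fin 6))) : ({0, 1, 2, 3, 4} : Finset (Fin 6)) ⊆ X := by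
  have h0 : 0 ∈ X := by
    simp only [Finset.mem_insert, Finset.mem_singleton] at hw'
    rcases hw' with rfl | rfl | rfl | rfl | rfl
    · exact hw
    · exact r0.mp hw
    · exact r0.mp (r1.mp hw)
    · exact r0.mp (r1.mp (r2.mp hw))
    · exact r0.mp (r1.mp (r2.mp (r3.mp hw)))
  simp only [Finset.insert_subset_iff, Finset.singleton_subset_iff]
  have h1 := r0.mpr h0
  have h2 := r1.mpr h1
  have h3 := r2.mpr h2
  exact ⟨h0, h1, h2, h3, r3.mpr h3⟩

theorem cyc3_aux {X : Finset (Fin 6)} (t0 : 1 ∈ X ↔ 0 ∈ X) (t1 : 2 ∈ X ↔ 1 ∈ X)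
    (t3 : 4 ∈ X ↔ 3 ∈ X) (t4 : 5 ∈ X ↔ 4 ∈ X) (w : Fin 6) (hw : w ∈ X) : 3 ≤ X.card := by
  have : ({0, 1, 2} : Finset (Fin 6)) ⊆ X ∨ ({3, 4, 5} : Finset (Fin 6)) ⊆ X := by
    simp only [Finset.insert_subset_iff, Finset.singleton_subset_iff]
    rw [t1, t0, t4, t3]
    have : w = 0 ∨ w = 1 ∨ w = 2 ∨ w = 3 ∨ w = 4 ∨ w = 5 := by
      clear hw; revert w; decide
    rcases this with rfl | rfl | rfl | rfl | rfl | rfl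
    · exact Or.inl ⟨hw, hw, hw⟩
    · exact Or.inl ⟨t0.mp hw, t0.mp hw, t0.mp hw⟩
    · have := t0.mp (t1.mp hw)
      exact Or.inl ⟨this, this, this⟩
    · exact Or.inr ⟨hw, hw, hw⟩
    · exact Or.inr ⟨t3.mp hw, t3.mp hw, t3.mp hw⟩
    · have := t3.mp (t4.mp hw)
      exact Or.inr ⟨this, this, this⟩
  rcases this with h' | h'
  · exact Finset.card_le_card h'
  · exact Finset.card_le_card h'

theorem core6_false (G : Tour6 → Finset (Fin 6) → Finset (Fin 6)) (h : Core6 G) : False := by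
  -- the regular five-cycle
  have c1 := (h.iso' D6 D6 {0, 1, 2, 3, 4} {0, 1, 2, 3, 4}
    (mk6 ![1, 2, 3, 4, 0, 5] ![4, 0, 1, 2, 3, 5] (by decide)) (by decide) (by decide)
    (by decide)).1
  have r0 : _ ↔ _ := c1 0
  have r1 : _ ↔ _ := c1 1
  have r2 : _ ↔ _ := c1 2
  have r3 : _ ↔ _ := c1 3
  have r4 : _ ↔ _ := c1 4
  change (1 : Fin 6) ∈ _ ↔ _ at r0
  change (2 : Fin 6) ∈ _ ↔ _ at r1
  change (3 : Fin 6) ∈ _ ↔ _ at r2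
  change (4 : Fin 6) ∈ _ ↔ _ at r3
  change (0 : Fin 6) ∈ _ ↔ _ at r4
  have call : ({0, 1, 2, 3, 4} : Finset (Fin 6)) ⊆ G D6 {0, 1, 2, 3, 4} := by
    obtain ⟨w, hw⟩ := h.ne D6 {0, 1, 2, 3, 4} (by decide)
    have hw' := h.sub D6 {0, 1, 2, 3, 4} (by decide) hw
    exact cyc5_aux r0 r1 r2 r3 w hw hw'
  have ccard : 5 ≤ (G D6 {0, 1, 2, 3, 4}).card := Finset.card_le_card call
  -- the four-vertex tournament
  have e2 : ({0, 1, 2, 3, 4} : Finset (Fin 6)).erase 2 = {0, 1, 3, 4} := by decide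
  have a4 : (G D6 {0, 1, 3, 4}).card ≤ 4 :=
    Finset.card_le_card (h.sub D6 {0, 1, 3, 4} (by decide))
  have n0 : 0 ∉ G D6 {0, 1, 3, 4} := fun hh => by
    have := (h.ga D6 {0, 1, 2, 3, 4} 0 2 (by decide) (by decide) (by decide) (by rwa [e2])).2
    rw [e2] at this; omega
  have n1 : 1 ∉ G D6 {0, 1, 3, 4} := fun hh => by
    have := (h.ga D6 {0, 1, 2, 3, 4} 1 2 (by decide) (by decide) (by decide) (by rwa [e2])).2
    rw [e2] at this; omega
  have asub : G D6 {0, 1, 3, 4} ⊆ {3, 4} := by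
    intro z hz
    have hz' := h.sub D6 {0, 1, 3, 4} (by decide) hz
    simp only [Finset.mem_insert, Finset.mem_singleton] at hz' ⊢
    rcases hz' with rfl | rfl | h' | h'
    · exact absurd hz n0
    · exact absurd hz n1
    · exact Or.inl h'
    · exact Or.inr h'
  have a2 : (G D6 {0, 1, 3, 4}).card ≤ 2 := Finset.card_le_card asub
  -- the five-vertex tournament
  have b0 := h.iso' D6 D6 {0, 1, 3, 4} {2, 3, 4, 5}
    (mk6 ![3, 4, 0, 5, 2, 1] ![2, 5, 4, 0, 1, 3] (by decide)) (by decide) (by decide)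
    (by decide)
  have b3 := h.iso' D6 D6 {0, 1, 3, 4} {0, 2, 4, 5}
    (mk6 ![0, 2, 1, 4, 5, 3] ![0, 2, 1, 5, 3, 4] (by decide)) (by decide) (by decide)
    (by decide)
  have f0 : ({0, 2, 3, 4, 5} : Finset (Fin 6)).erase 0 = {2, 3, 4, 5} := by decide
  have f3 : ({0, 2, 3, 4, 5} : Finset (Fin 6)).erase 3 = {0, 2, 4, 5} := by decide
  have hB : 5 ∈ G D6 {0, 2, 3, 4, 5} ∧ (G D6 {0, 2, 3, 4, 5}).card ≤ 2 := by
    obtain ⟨w, hw⟩ := h.ne D6 {0, 1, 3, 4} (by decide)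
    have hw' := asub hw
    simp only [Finset.mem_insert, Finset.mem_singleton] at hw'
    rcases hw' with rfl | rfl
    · have h5 : 5 ∈ G D6 {2, 3, 4, 5} := (b0.1 3).mpr hw
      have := h.ga D6 {0, 2, 3, 4, 5} 5 0 (by decide) (by decide) (by decide) (by rwa [f0])
      rw [f0, b0.2] at this
      exact ⟨this.1, this.2.trans a2⟩
    · have h5 : 5 ∈ G D6 {0, 2, 4, 5} := (b3.1 4).mpr hw
      have := h.ga D6 {0, 2, 3, 4, 5} 5 3 (by decide) (by decide) (by decide) (by rwa [f3])
      rw [f3, b3.2] at this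
      exact ⟨this.1, this.2.trans a2⟩
  -- the symmetric six-vertex tournament
  have s1 := (h.iso' S6 S6 {0, 1, 2, 3, 4, 5} {0, 1, 2, 3, 4, 5}
    (mk6 ![1, 2, 0, 4, 5, 3] ![2, 0, 1, 5, 3, 4] (by decide)) (by decide) (by decide)
    (by decide)).1
  have t0 : _ ↔ _ := s1 0
  have t1 : _ ↔ _ := s1 1
  have t2 : _ ↔ _ := s1 2
  have t3 : _ ↔ _ := s1 3
  have t4 : _ ↔ _ := s1 4
  have t5 : _ ↔ _ := s1 5
  change (1 : Fin 6) ∈ _ ↔ _ at t0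
  change (2 : Fin 6) ∈ _ ↔ _ at t1
  change (0 : Fin 6) ∈ _ ↔ _ at t2
  change (4 : Fin 6) ∈ _ ↔ _ at t3
  change (5 : Fin 6) ∈ _ ↔ _ at t4
  change (3 : Fin 6) ∈ _ ↔ _ at t5
  have scard : 3 ≤ (G S6 {0, 1, 2, 3, 4, 5}).card := by
    obtain ⟨w, hw⟩ := h.ne S6 {0, 1, 2, 3, 4, 5} (by decide)
    exact cyc3_aux t0 t1 t3 t4 w hw
  have u0 := h.iso' D6 S6 {0, 2, 3, 4, 5} {1, 2, 3, 4, 5}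
    (mk6 ![2, 0, 5, 1, 4, 3] ![1, 3, 0, 5, 4, 2] (by decide)) (by decide) (by decide)
    (by decide)
  have u4 := h.iso' D6 S6 {0, 2, 3, 4, 5} {0, 1, 2, 3, 5}
    (mk6 ![1, 4, 2, 5, 0, 3] ![4, 0, 2, 5, 1, 3] (by decide)) (by decide) (by decide)
    (by decide)
  have g0 : ({0, 1, 2, 3, 4, 5} : Finset (Fin 6)).erase 0 = {1, 2, 3, 4, 5} := by decide
  have g4 : ({0, 1, 2, 3, 4, 5} : Finset (Fin 6)).erase 4 = {0, 1, 2, 3, 5} := by decide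
  have k0 : ∀ x, S6.r x 0 = true → x ∈ ({0, 1, 2, 3, 4, 5} : Finset (Fin 6)) →
      x ∉ G S6 {1, 2, 3, 4, 5} := fun x hx hx' hh => by
    have := (h.ga S6 {0, 1, 2, 3, 4, 5} x 0 hx' (by decide) hx (by rwa [g0])).2
    rw [g0, u0.2] at this; omega
  have k4 : ∀ x, S6.r x 4 = true → x ∈ ({0, 1, 2, 3, 4, 5} : Finset (Fin 6)) →
      x ∉ G S6 {0, 1, 2, 3, 5} := fun x hx hx' hh => by
    have := (h.ga S6 {0, 1, 2, 3, 4, 5} x 4 hx' (by decide) hx (by rwa [g4])).2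
    rw [g4, u4.2] at this; omega
  have bsub : G D6 {0, 2, 3, 4, 5} ⊆ {5} := by
    intro z hz
    have hz' := h.sub D6 {0, 2, 3, 4, 5} (by decide) hz
    simp only [Finset.mem_insert, Finset.mem_singleton] at hz' ⊢
    rcases hz' with rfl | rfl | rfl | rfl | rfl
    · exact absurd ((u0.1 0).mpr hz) (k0 2 (by decide) (by decide))
    · exact absurd ((u0.1 2).mpr hz) (k0 5 (by decide) (by decide))
    · exact absurd ((u4.1 3).mpr hz) (k4 5 (by decide) (by decide))
    · exact absurd ((u0.1 4).mpr hz) (k0 4 (by decide) (by decide))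
    · rfl
  have bcard : (G D6 {0, 2, 3, 4, 5}).card ≤ 1 := Finset.card_le_card bsub
  -- the final contradiction
  have m1 : ({0, 1, 2, 3, 4, 5} : Finset (Fin 6)).erase 1 = {0, 2, 3, 4, 5} := by decide
  have m5 : ({0, 1, 2, 3, 4, 5} : Finset (Fin 6)).erase 5 = {0, 1, 2, 3, 4} := by decide
  have q5 := h.ga D6 {0, 1, 2, 3, 4, 5} 5 1 (by decide) (by decide) (by decide)
    (by rw [m1]; exact hB.1)
  have q4 := h.ga D6 {0, 1, 2, 3, 4, 5} 4 5 (by decide) (by decide) (by decide)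
    (by rw [m5]; exact call (by decide))
  rw [m1] at q5
  have := Finset.card_le_one.mp (q5.2.trans bcard) 5 q5.1 4 q4.1
  exact absurd this (by decide)

section method6

variable {C V : Type} (e : Fin 6 ↪ C) (v : Equiv.Perm (Fin 6) ↪ V)

/-- The winners of `F` in the profile of a tournament, as vertices. -/
def win6 (F : VotingMethod C V) (T : Tour6) (A : Finset (Fin 6)) : Finset (Fin 6) :=
  if hA : A.Nonempty then
    Finset.univ.filter (fun x => e x ∈ F.winners (prof6 e v T A hA 1 1))
  else ∅

theorem mem_win6 (F : VotingMethod C V) (T : Tour6) (A : Finset (Fin 6)) (hA : A.Nonempty)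
    (x : Fin 6) : x ∈ win6 e v F T A ↔ e x ∈ F.winners (prof6 e v T A hA 1 1) := by
  simp [win6, hA]

theorem prof6_dom (F : VotingMethod C V) (hd : F.dom = {P : Profile C V | P.cands.card ≤ 7})
    (T A hA σ τ) : prof6 e v T A hA σ τ ∈ F.dom := by
  rw [hd]
  have h1 : (prof6 e v T A hA σ τ).cands.card ≤ A.card := Finset.card_image_le
  have h2 : A.card ≤ 6 := by simpa using Finset.card_le_univ A
  show _ ≤ 7
  omega

theorem win6_image (F : VotingMethod C V) (hd : F.dom = {P : Profile C V | P.cands.card ≤ 7})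
    (T A hA) : (win6 e v F T A).image e = F.winners (prof6 e v T A hA 1 1) := by
  ext c
  simp only [Finset.mem_image, mem_win6 e v F T A hA]
  constructor
  · rintro ⟨x, hx, rfl⟩; exact hx
  · intro hc
    have := F.winners_sub _ (prof6_dom e v F hd T A hA 1 1) hc
    obtain ⟨x, _, hx⟩ := Finset.mem_image.mp this
    simp only [Equiv.Perm.one_apply] at hx
    exact ⟨x, by rwa [hx], hx⟩

theorem win6_card (F : VotingMethod C V) (hd : F.dom = {P : Profile C V | P.cands.card ≤ 7})
    (T A hA) : (F.winners (prof6 e v T A hA 1 1)).card = (win6 e v F T A).card := by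
  rw [← win6_image e v F hd, Finset.card_image_of_injective _ e.injective]

theorem win6_anon (F : VotingMethod C V) (hd : F.dom = {P : Profile C V | P.cands.card ≤ 7})
    (ha : F.Anonymous) (T A hA σ) (τ : Equiv.Perm (Equiv.Perm (Fin 6))) :
    F.winners (prof6 e v T A hA σ τ) = F.winners (prof6 e v T A hA σ 1) := by
  induction τ using Equiv.Perm.swap_induction_on' with
  | one => rfl
  | mul_swap f x y hxy ih =>
    rw [← ih, ← prof6_swapVoters]
    apply ha _ (prof6_dom e v F hd T A hA _ _)
    rw [prof6_swapVoters]
    exact prof6_dom e v F hd T A hA _ _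

theorem win6_neut (F : VotingMethod C V) (hd : F.dom = {P : Profile C V | P.cands.card ≤ 7})
    (ha : F.Neutral) (T A hA) (σ : Equiv.Perm (Fin 6)) (x : Fin 6) :
    e (σ x) ∈ F.winners (prof6 e v T A hA σ 1) ↔ e x ∈ F.winners (prof6 e v T A hA 1 1) := by
  induction σ using Equiv.Perm.swap_induction_on with
  | one => rfl
  | swap_mul f a b hab ih =>
    rw [← ih, ← prof6_swapCands, ha _ (prof6_dom e v F hd T A hA _ _)]
    · rw [Equiv.Perm.mul_apply, ← e.injective.swap_apply a b (f x)]
      exact (Equiv.swap (e a) (e b)).injective.mem_finset_image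
    · rw [prof6_swapCands]
      exact prof6_dom e v F hd T A hA _ _

theorem win6_iso (F : VotingMethod C V) (hd : F.dom = {P : Profile C V | P.cands.card ≤ 7})
    (ha : F.Anonymous) (hn : F.Neutral) (T T' : Tour6) (A : Finset (Fin 6))
    (σ : Equiv.Perm (Fin 6)) (hA : A.Nonempty)
    (h : ∀ x ∈ A, ∀ y ∈ A, T'.r (σ x) (σ y) = T.r x y) (x : Fin 6) :
    σ x ∈ win6 e v F T' (A.image σ) ↔ x ∈ win6 e v F T A := by
  rw [mem_win6 e v F T A hA, mem_win6 e v F T' _ (hA.image _),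
    prof6_iso e v T T' A hA σ (hA.image _) h, win6_anon e v F hd ha, win6_neut e v F hd hn]

theorem win6_ga (F : VotingMethod C V) (hd : F.dom = {P : Profile C V | P.cands.card ≤ 7})
    (hg : F.BinaryGamma) (hr : F.AlphaResolute) (T : Tour6) (A : Finset (Fin 6)) (x y : Fin 6)
    (hx : x ∈ A) (hy : y ∈ A) (hxy : x ≠ y) (hw : win6 e v F T {x, y} = {x})
    (h : x ∈ win6 e v F T (A.erase y)) :
    x ∈ win6 e v F T A ∧ (win6 e v F T A).card ≤ (win6 e v F T (A.erase y)).card := by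
  have hA : A.Nonempty := ⟨x, hx⟩
  have hE : (A.erase y).Nonempty := ⟨x, Finset.mem_erase.mpr ⟨hxy, hx⟩⟩
  have hP : ({x, y} : Finset (Fin 6)).Nonempty := ⟨x, by simp⟩
  have hx' : e x ∈ (prof6 e v T A hA 1 1).cands := Finset.mem_image.mpr ⟨x, hx, rfl⟩
  have hy' : e y ∈ (prof6 e v T A hA 1 1).cands := Finset.mem_image.mpr ⟨y, hy, rfl⟩
  have hne : e x ≠ e y := fun h => hxy (e.injective h)
  have hE' : ((prof6 e v T A hA 1 1).cands.erase (e y)).Nonempty :=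
    ⟨e x, Finset.mem_erase.mpr ⟨hne, hx'⟩⟩
  have em := prof6_minus e v T A hA y hE hE'
  have ep := prof6_pair e v T A hA x y hx hy hx' hy' hP
  have d1 : (prof6 e v T A hA 1 1).minus (e y) hE' ∈ F.dom := by
    rw [em]; exact prof6_dom e v F hd _ _ _ _ _
  have d2 : (prof6 e v T A hA 1 1).pair (e x) (e y) hx' hy' ∈ F.dom := by
    rw [ep]; exact prof6_dom e v F hd _ _ _ _ _
  have w1 : e x ∈ F.winners ((prof6 e v T A hA 1 1).minus (e y) hE') := by
    rw [em]; exact (mem_win6 e v F T _ hE x).mp h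
  have w2 : F.winners ((prof6 e v T A hA 1 1).pair (e x) (e y) hx' hy') = {e x} := by
    rw [ep, ← win6_image e v F hd, hw]; simp
  have d0 := prof6_dom e v F hd T A hA 1 1
  constructor
  · rw [mem_win6 e v F T A hA]
    exact hg _ d0 _ hx' _ hy' hne hE' d1 d2 w1 w2
  · have := hr _ d0 _ hx' _ hy' hne hE' d1 d2 w1 w2
    rwa [em, win6_card e v F hd, win6_card e v F hd] at this

theorem win6_pair (F : VotingMethod C V) (hd : F.dom = {P : Profile C V | P.cands.card ≤ 7})
    (hq : F.BinaryQuasiResolute) (T : Tour6) (x y : Fin 6) (hxy : T.r x y = true) :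
    win6 e v F T {x, y} = {x} ∨ win6 e v F T {x, y} = {y} := by
  have hP : ({x, y} : Finset (Fin 6)).Nonempty := ⟨x, by simp⟩
  have hne : x ≠ y := by rintro rfl; exact T.irr _ hxy
  have hc : (prof6 e v T {x, y} hP 1 1).cands = {e x, e y} := by
    simp [prof6, Finset.image_insert]
  have hm := prof6_margin e v T x y hxy hP
  have hm' : (prof6 e v T {x, y} hP 1 1).margin (e y) (e x) =
    - (prof6 e v T {x, y} hP 1 1).margin (e x) (e y) := by
    simp [Profile.margin]
  have := hq _ (prof6_dom e v F hd T {x, y} hP 1 1)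
    (by rw [hc]; exact Finset.card_pair (fun h => hne (e.injective h)))
    (by
      rw [hc]
      intro a ha b hb hab
      simp only [Finset.mem_insert, Finset.mem_singleton] at ha hb
      rcases ha with rfl | rfl <;> rcases hb with rfl | rfl
      · exact absurd rfl hab
      · exact hm.ne'
      · rw [hm']; omega
      · exact absurd rfl hab)
  rw [win6_card e v F hd, Finset.card_eq_one] at this
  obtain ⟨z, hz⟩ := this
  have hz1 : z ∈ win6 e v F T {x, y} := by rw [hz]; simp
  rw [mem_win6 e v F T _ hP] at hz1
  have := F.winners_sub _ (prof6_dom e v F hd T {x, y} hP 1 1) hz1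
  rw [hc] at this
  simp only [Finset.mem_insert, Finset.mem_singleton, e.injective.eq_iff] at this
  rcases this with rfl | rfl
  · exact Or.inl hz
  · exact Or.inr hz

theorem win6_false (e : Fin 6 ↪ C) (v : Equiv.Perm (Fin 6) ↪ V) (F : VotingMethod C V) (hd : F.dom = {P : Profile C V | P.cands.card ≤ 7})
    (ha : F.Anonymous) (hn : F.Neutral) (hq : F.BinaryQuasiResolute) (hg : F.BinaryGamma)
    (hr : F.AlphaResolute) : False := by
  have hne : ∀ T A, A.Nonempty → (win6 e v F T A).Nonempty := by
    intro T A hA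
    rw [← Finset.card_pos, ← win6_card e v F hd T A hA, Finset.card_pos]
    exact F.winners_nonempty _ (prof6_dom e v F hd T A hA 1 1)
  have hsub : ∀ T A, A.Nonempty → win6 e v F T A ⊆ A := by
    intro T A hA x hx
    rw [mem_win6 e v F T A hA] at hx
    have := F.winners_sub _ (prof6_dom e v F hd T A hA 1 1) hx
    obtain ⟨y, hy, hxy⟩ := Finset.mem_image.mp this
    rw [← e.injective hxy]
    exact hy
  -- pairs behave uniformly
  have hun : ∀ T T' x y x' y', Tour6.r T x y = true → Tour6.r T' x' y' = true →
      x ∈ win6 e v F T {x, y} → x' ∈ win6 e v F T' {x', y'} := by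
    intro T T' x y x' y' h h' hx
    have n1 : x ≠ y := by rintro rfl; exact T.irr _ h
    have n2 : x' ≠ y' := by rintro rfl; exact T'.irr _ h'
    let σ : Equiv.Perm (Fin 6) := Equiv.swap (Equiv.swap x x' y) y' * Equiv.swap x x'
    have s1 : σ y = y' := by simp [σ]
    have s0 : σ x = x' := by
      simp only [σ, Equiv.Perm.mul_apply, Equiv.swap_apply_left]
      apply Equiv.swap_apply_of_ne_of_ne
      · intro h
        apply n1
        apply (Equiv.swap x x').injective
        rw [← h]; simp
      · exact n2
    have := win6_iso e v F hd ha hn T T' {x, y} σ ⟨x, by simp⟩ (by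
      intro a ha b hb
      have := T.irr
      have := T'.irr
      have := T.asymm _ _ h
      have := T'.asymm _ _ h'
      simp only [Finset.mem_insert, Finset.mem_singleton] at ha hb
      rcases ha with rfl | rfl <;> rcases hb with rfl | rfl <;> simp_all) x
    rw [s0, Finset.image_insert, Finset.image_singleton, s0, s1] at this
    exact this.mpr hx
  by_cases hcase : ∃ T x y, Tour6.r T x y = true ∧ x ∈ win6 e v F T {x, y}
  · obtain ⟨T0, x0, y0, h0, hw0⟩ := hcase
    refine core6_false (win6 e v F) ⟨hne, hsub, ?_, ?_⟩
    · intro T T' A σ hA h x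
      exact win6_iso e v F hd ha hn T T' A σ hA h x
    · intro T A x y hx hy hxy h
      have n1 : x ≠ y := by rintro rfl; exact T.irr _ hxy
      refine win6_ga e v F hd hg hr T A x y hx hy n1 ?_ h
      have hm := hun T0 T x0 y0 x y h0 hxy hw0
      rcases win6_pair e v F hd hq T x y hxy with h' | h'
      · exact h'
      · rw [h'] at hm
        exact absurd (Finset.mem_singleton.mp hm) n1
  · push Not at hcase
    refine core6_false (fun T => win6 e v F T.rev) ⟨fun T => hne T.rev, fun T => hsub T.rev, ?_, ?_⟩
    · intro T T' A σ hA h x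
      exact win6_iso e v F hd ha hn T.rev T'.rev A σ hA (fun a ha b hb => h b hb a ha) x
    · intro T A x y hx hy hxy h
      have n1 : x ≠ y := by rintro rfl; exact T.irr _ hxy
      refine win6_ga e v F hd hg hr T.rev A x y hx hy n1 ?_ h
      have hm := hcase T.rev y x hxy
      rcases win6_pair e v F hd hq T.rev y x hxy with h' | h'
      · rw [h'] at hm
        exact absurd (Finset.mem_singleton_self y) hm
      · rw [Finset.pair_comm]
        exact h'

end method6

/-- There is no voting method whose domain is the set of all profiles
with at most 7 candidates that satisfies anonymity, neutrality, binary
quasi-resoluteness, binary γ, and α-resoluteness. -/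
theorem no_voting_method_seven_candidates (C V : Type) [Infinite C] [Infinite V] :
    ¬ ∃ F : VotingMethod C V,
      F.dom = {P : Profile C V | P.cands.card ≤ 7} ∧
      F.Anonymous ∧ F.Neutral ∧ F.BinaryQuasiResolute ∧ F.BinaryGamma ∧
      F.AlphaResolute := by
  rintro ⟨F, hd, ha, hn, hq, hg, hr⟩
  let e : Fin 6 ↪ C := Fin.valEmbedding.trans (Infinite.natEmbedding C)
  let v : Equiv.Perm (Fin 6) ↪ V :=
    (Fintype.equivFin (Equiv.Perm (Fin 6))).toEmbedding.trans
      (Fin.valEmbedding.trans (Infinite.natEmbedding V))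
  exact win6_false e v F hd ha hn hq hg hr
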